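/- arXiv:2007.09116 — 2 statements merged into one kernel-verified Lean document; each statement's English description precedes it below -/
import Mathlib

section
/- Let n ≥ 2 and k ≥ 0 be integers and let ℓ be an integer with ℓ ≥ 300000·(log n)³. Let R be a finite set, let 𝒞' be a finite indexed family of subsets of R such that every element of R lies in at most ℓ members of 𝒞' (counted with multiplicity), and let C ⊆ R with |C| ≥ ℓ^{k+3}. Consider the probability space in which each element of R is independently kept with probability ℓ^{-k}, and let R_k denote the random set of kept elements. Then with probability at least 1 − 1/n^{10} one has Σ_{C'∈𝒞'} |C' ∩ C ∩ R_k| ≤ (10/ℓ^{k}) · ( |C| + Σ_{C'∈𝒞'} |C' ∩ C| ). -/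
open MeasureTheory

/-- The Bernoulli(p) measure on `Bool`: mass `p` on `true` and `1 - p` on `false`. -/
noncomputable def bernoulliMeasure (p : ENNReal) : Measure Bool :=
  p • Measure.dirac true + (1 - p) • Measure.dirac false

/-- The product measure on `S → Bool` in which each coordinate is independently
`true` (kept) with probability `p`. -/
noncomputable def keepMeasure (S : Type) [Fintype S] (p : ENNReal) :
    Measure (S → Bool) :=
  Measure.pi fun _ : S => bernoulliMeasure p

lemma isProbabilityMeasure_bernoulliMeasure {p : ENNReal} (hp : p ≤ 1) :
    IsProbabilityMeasure (bernoulliMeasure p) := by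
  constructor
  simp [bernoulliMeasure, add_tsub_cancel_of_le hp]

lemma isProbabilityMeasure_keepMeasure (S : Type) [Fintype S] {p : ENNReal} (hp : p ≤ 1) :
    IsProbabilityMeasure (keepMeasure S p) := by
  have := isProbabilityMeasure_bernoulliMeasure hp
  unfold keepMeasure
  infer_instance

lemma integral_bernoulliMeasure {p : ENNReal} (hp : p ≤ 1) (f : Bool → ℝ) :
    ∫ b, f b ∂bernoulliMeasure p = p.toReal * f true + (1 - p.toReal) * f false := by
  have := isProbabilityMeasure_bernoulliMeasure hp
  rw [integral_fintype Integrable.of_finite]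
  simp [bernoulliMeasure, Measure.real, ENNReal.toReal_sub_of_le hp]

lemma integral_exp_bernoulliMeasure_le {p : ENNReal} (hp : p ≤ 1) {w : ℝ} (hw0 : 0 ≤ w)
    (hw1 : w ≤ 1) :
    ∫ b, Real.exp (if b = true then w else 0) ∂bernoulliMeasure p ≤
      Real.exp (2 * p.toReal * w) := by
  rw [integral_bernoulliMeasure hp]
  have h : Real.exp w ≤ 1 + 2 * w := by
    have h1 := Real.abs_exp_sub_one_le (x := w) (by rwa [abs_of_nonneg hw0])
    rw [abs_of_nonneg hw0] at h1
    linarith [le_abs_self (Real.exp w - 1)]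
  have h2 := mul_le_mul_of_nonneg_left h (ENNReal.toReal_nonneg (a := p))
  have h3 := Real.add_one_le_exp (2 * p.toReal * w)
  simp only [if_true, Bool.false_eq_true, if_false, Real.exp_zero]
  linarith

/-- A Chernoff bound for weighted sums of independent Bernoulli variables with weights in
`[0, 1]`. -/
lemma keepMeasure_real_le_sum_le {S : Type} [Fintype S] {p : ENNReal} (hp : p ≤ 1) {w : S → ℝ}
    (hw0 : ∀ i, 0 ≤ w i) (hw1 : ∀ i, w i ≤ 1) (a : ℝ) :
    (keepMeasure S p).real {ω | a ≤ ∑ i, if ω i = true then w i else 0} ≤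
      Real.exp (2 * p.toReal * ∑ i, w i - a) := by
  have := isProbabilityMeasure_bernoulliMeasure hp
  have := isProbabilityMeasure_keepMeasure S hp
  refine (ProbabilityTheory.measure_ge_le_exp_mul_mgf (t := 1) a zero_le_one
    Integrable.of_finite).trans ?_
  have h : ProbabilityTheory.mgf (fun ω : S → Bool => ∑ i, if ω i = true then w i else 0)
      (keepMeasure S p) 1 ≤
      Real.exp (2 * p.toReal * ∑ i, w i) := by
    simp only [ProbabilityTheory.mgf, one_mul, Real.exp_sum, keepMeasure]
    rw [integral_fintype_prod_eq_prod
      (f := fun i (b : Bool) => Real.exp (if b = true then w i else 0)), Finset.mul_sum,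
      Real.exp_sum]
    exact Finset.prod_le_prod (fun i _ => integral_nonneg fun b => (Real.exp_pos _).le)
      fun i _ => integral_exp_bernoulliMeasure_le hp (hw0 i) (hw1 i)
  calc _ ≤ Real.exp (-1 * a) * Real.exp (2 * p.toReal * ∑ i, w i) := by gcongr
    _ = _ := by rw [← Real.exp_add]; ring_nf

/-- Double counting: total size of a family of sets restricted to a predicate. -/
lemma sum_card_filter_eq_sum_degree {S ι : Type} [Fintype S] [DecidableEq S] [Fintype ι]
    (A : ι → Finset S) (P : S → Prop) [DecidablePred P] :
    (∑ t, (((A t).filter P).card : ℝ)) =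
      ∑ i, if P i then ((Finset.univ.filter fun t => i ∈ A t).card : ℝ) else 0 := by
  simp only [Finset.card_filter, Nat.cast_sum, Nat.cast_ite, Nat.cast_one, Nat.cast_zero]
  calc _ = ∑ t, ∑ i, if i ∈ A t then (if P i then (1 : ℝ) else 0) else 0 := by simp
    _ = _ := by
      rw [Finset.sum_comm]
      refine Finset.sum_congr rfl fun i _ => ?_
      split_ifs <;> simp

lemma log_le_sq_of_le {n : ℕ} {l : ℝ} (hn : 2 ≤ n) (hl : 300000 * Real.log n ^ 3 ≤ l) :
    1 ≤ l ∧ Real.log n ≤ l ^ 2 := by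
  have h1 : 0.69 ≤ Real.log n :=
    (by linarith [Real.log_two_gt_d9] : (0.69 : ℝ) ≤ Real.log 2).trans
      (Real.log_le_log (by norm_num) (by exact_mod_cast hn))
  have h2 : (0.69 : ℝ) ^ 2 ≤ Real.log n ^ 2 := by gcongr
  have h3 : Real.log n ^ 3 = Real.log n ^ 2 * Real.log n := by ring
  have h4 := mul_le_mul_of_nonneg_right h2 (by linarith : 0 ≤ Real.log n)
  have h5 : 2 * Real.log n ≤ l := by linarith
  constructor <;> nlinarith

lemma exp_sub_le_one_div_pow {n k : ℕ} {l c D : ℝ} (hn : 2 ≤ n) (hl0 : 0 < l)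
    (hlog : Real.log n ≤ l ^ 2) (hD0 : 0 ≤ D) (hc : l ^ (k + 3) ≤ c) :
    Real.exp (2 * (l ^ k)⁻¹ * (D / l) - 10 / l ^ k * (c + D) / l) ≤ 1 / (n : ℝ) ^ 10 := by
  have hn0 : (0 : ℝ) < n := by positivity
  rw [← Real.le_log_iff_exp_le (by positivity), one_div, Real.log_inv, Real.log_pow]
  have hCl : l ^ 2 ≤ c / l ^ k / l := by
    rw [div_div, le_div_iff₀ (by positivity)]
    calc l ^ 2 * (l ^ k * l) = l ^ (k + 3) := by ring
      _ ≤ c := hc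
  have hnn : 0 ≤ D / l ^ k / l := by positivity
  have heq : 2 * (l ^ k)⁻¹ * (D / l) - 10 / l ^ k * (c + D) / l =
      -8 * (D / l ^ k / l) - 10 * (c / l ^ k / l) := by
    field_simp
    ring
  rw [heq]
  push_cast
  linarith

/-- If every element of `R` is in at most `ℓ` members of `𝒞'` (with
multiplicity) and `|C| ≥ ℓ^(k+3)`, then keeping each element independently with
probability `ℓ⁻ᵏ`, with probability at least `1 − 1/n¹⁰` the total intersection of the
members of `𝒞'` with `C` restricted to the kept set `R_k` is at most
`(10/ℓᵏ)·(|C| + Σ_{C'} |C' ∩ C|)`. -/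
theorem overlap_concentration
    (n k ℓ : ℕ) (hn : 2 ≤ n) (hℓ : (300000 : ℝ) * Real.log n ^ 3 ≤ (ℓ : ℝ))
    (S : Type) [Fintype S] [DecidableEq S] (R : Finset S)
    (ι : Type) [Fintype ι] (𝒞' : ι → Finset S)
    (hsub : ∀ t : ι, 𝒞' t ⊆ R)
    (hdeg : ∀ j ∈ R, (Finset.univ.filter (fun t : ι => j ∈ 𝒞' t)).card ≤ ℓ)
    (C : Finset S) (hCR : C ⊆ R) (hC : ℓ ^ (k + 3) ≤ C.card) :
    1 - 1 / (n : ENNReal) ^ 10 ≤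
      keepMeasure S ((ℓ : ENNReal)⁻¹ ^ k)
        {ω : S → Bool |
          (∑ t : ι, (((𝒞' t ∩ C).filter fun i => ω i).card : ℝ)) ≤
            (10 / (ℓ : ℝ) ^ k) * ((C.card : ℝ) + ∑ t : ι, ((𝒞' t ∩ C).card : ℝ))} := by
  classical
  obtain ⟨hl1, hlog⟩ := log_le_sq_of_le hn hℓ
  have hl0 : (0 : ℝ) < ℓ := by linarith
  have hp : (ℓ : ENNReal)⁻¹ ^ k ≤ 1 :=
    pow_le_one₀ (by simp) (ENNReal.inv_le_one.2 (by exact_mod_cast hl1))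
  have hpr : ((ℓ : ENNReal)⁻¹ ^ k).toReal = ((ℓ : ℝ) ^ k)⁻¹ := by simp
  have := isProbabilityMeasure_keepMeasure S hp
  set d : S → ℝ := fun i => ((Finset.univ.filter fun t => i ∈ 𝒞' t ∩ C).card : ℝ) with hd
  have hdl : ∀ i, d i ≤ ℓ := by
    intro i
    by_cases hi : i ∈ C
    · simpa [hd, hi] using hdeg i (hCR hi)
    · simp [hd, hi]
  have hD : ∑ t : ι, ((𝒞' t ∩ C).card : ℝ) = ∑ i, d i := by
    simpa [hd] using sum_card_filter_eq_sum_degree (fun t => 𝒞' t ∩ C) (fun _ => True)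
  set D := ∑ i, d i
  have hD0 : 0 ≤ D := Finset.sum_nonneg fun i _ => Nat.cast_nonneg _
  set a : ℝ := 10 / (ℓ : ℝ) ^ k * (C.card + D) / ℓ with ha
  have hch := keepMeasure_real_le_sum_le hp (w := fun i => d i / ℓ)
    (fun i => by positivity) (fun i => (div_le_one hl0).2 (hdl i)) a
  have hexp : Real.exp (2 * ((ℓ : ENNReal)⁻¹ ^ k).toReal * ∑ i, d i / ℓ - a) ≤
      1 / (n : ℝ) ^ 10 := by
    rw [hpr, ← Finset.sum_div]
    exact exp_sub_le_one_div_pow hn hl0 hlog hD0 (by exact_mod_cast hC)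
  set G := {ω : S → Bool |
    (∑ t : ι, (((𝒞' t ∩ C).filter fun i => ω i).card : ℝ)) ≤
      (10 / (ℓ : ℝ) ^ k) * ((C.card : ℝ) + ∑ t : ι, ((𝒞' t ∩ C).card : ℝ))} with hG
  have hsubset : Gᶜ ⊆ {ω | a ≤ ∑ i, if ω i = true then d i / ℓ else 0} := by
    intro ω hω
    simp only [hG, Set.mem_compl_iff, Set.mem_ofPred_eq, not_le, hD] at hω
    rw [sum_card_filter_eq_sum_degree] at hω
    have hsum : (∑ i, if ω i = true then d i / ℓ else 0) =
        (∑ i, if ω i = true then d i else 0) / ℓ := by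
      rw [Finset.sum_div]
      exact Finset.sum_congr rfl fun i _ => by split_ifs <;> simp
    rw [Set.mem_ofPred_eq, hsum, ha]
    gcongr
  have hbad : (keepMeasure S ((ℓ : ENNReal)⁻¹ ^ k)).real Gᶜ ≤ 1 / (n : ℝ) ^ 10 :=
    (measureReal_mono hsubset).trans (hch.trans hexp)
  have hGm : MeasurableSet G := G.toFinite.measurableSet
  have hbad' : keepMeasure S ((ℓ : ENNReal)⁻¹ ^ k) Gᶜ ≤ 1 / (n : ENNReal) ^ 10 := by
    have hn0 : (n : ENNReal) ≠ 0 := by exact_mod_cast (by omega : n ≠ 0)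
    rw [← ENNReal.toReal_le_toReal (measure_ne_top _ _)
      (ENNReal.div_ne_top ENNReal.one_ne_top (pow_ne_zero _ hn0))]
    simpa [Measure.real] using hbad
  have hsum := prob_add_prob_compl (μ := keepMeasure S ((ℓ : ENNReal)⁻¹ ^ k)) hGm
  exact tsub_le_iff_right.2 (hsum.ge.trans (by gcongr))
end

section
/- Let R be a finite set, let (C_t)_{t∈T} be a finite indexed family of subsets of R, and let ℓ ≥ 1 be an integer such that every element of R lies in at most 2ℓ of the sets C_t (counted with multiplicity). Then there exist sets K_t ⊆ C_t for each t ∈ T with |K_t| ≥ ⌊|C_t|/2⌋ such that every element of R lies in at most ℓ of the sets K_t (counted with multiplicity). -/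
/-- A finset can be enumerated by an initial segment of the naturals. -/
lemma Finset.exists_injOn_range_card_mem {α : Type*} [Inhabited α] (s : Finset α) :
    ∃ h : ℕ → α, (∀ m < s.card, h m ∈ s) ∧
      ∀ m < s.card, ∀ n < s.card, h m = h n → m = n := by
  refine ⟨fun m => if hm : m < s.card then (s.equivFin.symm ⟨m, hm⟩ : α) else default, ?_, ?_⟩
  · intro m hm
    simp [hm]
  · intro m hm n hn h
    simpa [hm, hn, Subtype.val_inj] using h

/-- The elements of a finset can be ranked by distinct naturals below its cardinality. -/
lemma Finset.exists_injOn_lt_card {α : Type*} [DecidableEq α] (s : Finset α) :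
    ∃ r : α → ℕ, (∀ a ∈ s, r a < s.card) ∧ ∀ a ∈ s, ∀ b ∈ s, r a = r b → a = b := by
  refine ⟨fun a => if ha : a ∈ s then (s.equivFin ⟨a, ha⟩ : ℕ) else 0, ?_, ?_⟩
  · intro a ha
    simp [ha]
  · intro a ha b hb h
    simpa [ha, hb, Fin.val_inj] using h

/-- If every element of `R` lies in at most `2ℓ` of the sets `C_t`
(with multiplicity), then one can choose `K_t ⊆ C_t` with `|K_t| ≥ ⌊|C_t|/2⌋` such that
every element of `R` lies in at most `ℓ` of the sets `K_t`. -/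
theorem halving_step
    (τ : Type) [DecidableEq τ] (R : Finset τ)
    (T : Type) [Fintype T] [DecidableEq T]
    (C : T → Finset τ) (hC : ∀ t : T, C t ⊆ R)
    (ℓ : ℕ) (hℓ : 1 ≤ ℓ)
    (hdeg : ∀ i ∈ R, (Finset.univ.filter (fun t : T => i ∈ C t)).card ≤ 2 * ℓ) :
    ∃ K : T → Finset τ,
      (∀ t : T, K t ⊆ C t ∧ (C t).card / 2 ≤ (K t).card) ∧
      (∀ i ∈ R, (Finset.univ.filter (fun t : T => i ∈ K t)).card ≤ ℓ) := by
  rcases isEmpty_or_nonempty τ with hτ | ⟨⟨i₀⟩⟩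
  · exact ⟨C, fun t => ⟨subset_rfl, Nat.div_le_self _ _⟩, fun i => hτ.elim i⟩
  have : Inhabited τ := ⟨i₀⟩
  choose h h_mem h_inj using fun t => (C t).exists_injOn_range_card_mem
  choose r r_lt r_inj using
    fun i => (Finset.univ.filter (fun t : T => i ∈ C t)).exists_injOn_lt_card
  simp only [Finset.mem_filter, Finset.mem_univ, true_and] at r_lt r_inj
  -- Pair up the elements of each `C t`, and the sets containing each `i`, and apply Hall's
  -- theorem to these two families of pairs.
  let F : (Σ t, Fin ((C t).card / 2)) × Fin 2 → τ × ℕ := fun x =>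
    (h x.1.1 (2 * x.1.2 + x.2), r (h x.1.1 (2 * x.1.2 + x.2)) x.1.1 / 2)
  have idx_lt (x : Σ t, Fin ((C t).card / 2)) (b : Fin 2) :
      2 * (x.2 : ℕ) + b < (C x.1).card := by
    have := x.2.2
    have := b.2
    omega
  have F_fiber (p : τ × ℕ) (E : Finset ((Σ t, Fin ((C t).card / 2)) × Fin 2)) :
      (E.filter (fun x => F x = p)).card ≤ 2 := by
    have hcard : (Finset.Ico (2 * p.2) (2 * p.2 + 2)).card = 2 := by simp
    refine le_of_le_of_eq ?_ hcard
    refine Finset.card_le_card_of_injOn (fun x => r p.1 x.1.1) ?_ ?_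
    · intro x hx
      obtain ⟨-, rfl⟩ := Finset.mem_filter.1 hx
      simp only [F, Finset.coe_Ico, Set.mem_Ico]
      omega
    · rintro ⟨⟨t, j⟩, b⟩ hx ⟨⟨t', j'⟩, b'⟩ hx' hr
      have e := congrArg Prod.fst (Finset.mem_filter.1 hx).2
      have e' := congrArg Prod.fst (Finset.mem_filter.1 hx').2
      simp only [F] at e e' hr
      have m := h_mem t _ (idx_lt ⟨t, j⟩ b)
      have m' := h_mem t' _ (idx_lt ⟨t', j'⟩ b')
      simp only [e, e'] at m m'
      obtain rfl := r_inj _ _ m _ m' hr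
      have := h_inj t _ (idx_lt ⟨t, j⟩ b) _ (idx_lt ⟨t, j'⟩ b') (e.trans e'.symm)
      simp only at this
      have hj : j = j' := Fin.ext (by omega)
      have hb : b = b' := Fin.ext (by omega)
      rw [hj, hb]
  obtain ⟨f, f_inj, hf⟩ := (Finset.all_card_le_biUnion_card_iff_exists_injective
    (fun x => Finset.univ.image (fun b => F (x, b)))).1 (by
      intro s
      have himg : s.biUnion (fun x => Finset.univ.image (fun b => F (x, b))) =
          (s ×ˢ Finset.univ).image F := by
        ext p
        simp
      rw [himg]
      have := Finset.card_le_mul_card_image (f := F) (s ×ˢ Finset.univ) 2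
        (fun p _ => F_fiber p _)
      simp only [Finset.card_product, Finset.card_univ, Fintype.card_fin] at this
      omega)
  simp only [Finset.mem_image, Finset.mem_univ, true_and] at hf
  choose b hb using hf
  have f_fst (x) : (f x).1 = h x.1 (2 * x.2 + b x) := by rw [← hb x]
  have f_snd (x) : (f x).2 = r (f x).1 x.1 / 2 := by rw [← hb x]
  have f_mem (x) : (f x).1 ∈ C x.1 := by
    rw [f_fst]
    exact h_mem _ _ (idx_lt x _)
  refine ⟨fun t => Finset.univ.image (fun j => (f ⟨t, j⟩).1), fun t => ⟨?_, ?_⟩, ?_⟩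
  · intro i hi
    obtain ⟨j, -, rfl⟩ := Finset.mem_image.1 hi
    exact f_mem ⟨t, j⟩
  · rw [Finset.card_image_of_injective, Finset.card_univ, Fintype.card_fin]
    intro j j' hj
    simp only [f_fst] at hj
    have := h_inj t _ (idx_lt ⟨t, j⟩ _) _ (idx_lt ⟨t, j'⟩ _) hj
    simp only at this
    exact Fin.ext (by omega)
  · intro i hi
    rw [← Finset.card_range ℓ]
    refine Finset.card_le_card_of_injOn (fun t => r i t / 2) ?_ ?_
    · intro t ht
      obtain ⟨j, -, rfl⟩ := Finset.mem_image.1 (Finset.mem_filter.1 ht).2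
      have := r_lt _ t (f_mem ⟨t, j⟩)
      have := hdeg _ hi
      simp only [Finset.coe_range, Set.mem_Iio]
      omega
    · intro t ht t' ht' hr
      obtain ⟨j, -, e⟩ := Finset.mem_image.1 (Finset.mem_filter.1 ht).2
      obtain ⟨j', -, e'⟩ := Finset.mem_image.1 (Finset.mem_filter.1 ht').2
      have hff : f ⟨t, j⟩ = f ⟨t', j'⟩ := by
        refine Prod.ext (e.trans e'.symm) ?_
        rw [f_snd, f_snd, e, e']
        exact hr
      exact congrArg Sigma.fst (f_inj hff)
end
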